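/- Let B and A be complex vector spaces and let # : A → B and J : B → A be complex-linear maps with J injective. Suppose that for every v ∈ B there exist u, w ∈ B such that: (i) u − (i/2)·#(J u) = w + (i/2)·#(J w); (ii) v = u − (i/2)·#(J w); and (iii) J v = J u + J w. Then the complex-linear operator J₀ := (1/2)·(# ∘ J) : B → B satisfies J₀ ∘ J₀ = −id_B. In particular # ∘ J is bijective, # is surjective, and if J is bijective then # is bijective. -/

import Mathlib

/-- If `# : A → B` and `J : B → A` are complex-linear maps with `J` injective,
and every `v ∈ B` factors as in the multiplicativity conditions (i)-(iii), then
`J₀ := (1/2)·(# ∘ J)` satisfies `J₀ ∘ J₀ = -id`; in particular `# ∘ J` is bijective,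
`#` is surjective, and if `J` is bijective then `#` is bijective. -/
theorem stmt1 {A B : Type*} [AddCommGroup A] [Module ℂ A] [AddCommGroup B] [Module ℂ B]
    (sharp : A →ₗ[ℂ] B) (J : B →ₗ[ℂ] A) (hJ : Function.Injective J)
    (h : ∀ v : B, ∃ u w : B,
      u - (Complex.I / 2) • sharp (J u) = w + (Complex.I / 2) • sharp (J w) ∧
      v = u - (Complex.I / 2) • sharp (J w) ∧
      J v = J u + J w) :
    (((1 : ℂ) / 2) • (sharp ∘ₗ J)) ∘ₗ (((1 : ℂ) / 2) • (sharp ∘ₗ J)) =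
        -(LinearMap.id : B →ₗ[ℂ] B) ∧
    Function.Bijective (sharp ∘ₗ J) ∧
    Function.Surjective sharp ∧
    (Function.Bijective J → Function.Bijective sharp) := by
  have hsq : ∀ v, sharp (J (sharp (J v))) = (-4 : ℂ) • v := by
    intro v
    obtain ⟨u, w, h₁, h₂, h₃⟩ := h v
    have hv : v = u + w := hJ (by rw [h₃, map_add])
    have hIw : (Complex.I / 2) • sharp (J w) = -w := by
      have huw : u + w = u - (Complex.I / 2) • sharp (J w) := hv.symm.trans h₂
      rw [sub_eq_add_neg] at huw
      exact (neg_eq_iff_eq_neg.2 (add_left_cancel huw)).symm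
    have hIu : (Complex.I / 2) • sharp (J u) = u := by
      rw [hIw, add_neg_cancel, sub_eq_zero] at h₁
      exact h₁.symm
    have hI : (-2 * Complex.I) * (Complex.I / 2) = 1 := by
      linear_combination -Complex.I_mul_I
    have hw : sharp (J w) = (2 * Complex.I) • w := by
      rw [← one_smul ℂ (sharp (J w)), ← hI, mul_smul, hIw, smul_neg, ← neg_smul]
      congr 1
      ring
    have hu : sharp (J u) = (-2 * Complex.I) • u := by
      rw [← one_smul ℂ (sharp (J u)), ← hI, mul_smul, hIu]
    have hI₁ : (-2 * Complex.I) * (-2 * Complex.I) = -4 := by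
      linear_combination 4 * Complex.I_mul_I
    have hI₂ : (2 * Complex.I) * (2 * Complex.I) = -4 := by
      linear_combination 4 * Complex.I_mul_I
    simp only [hv, map_add, hu, hw, map_smul, smul_smul, hI₁, hI₂, smul_add]
  have hbij : Function.Bijective (sharp ∘ₗ J) := by
    refine ⟨fun x y hxy => ?_, fun v => ⟨(-1 / 4 : ℂ) • sharp (J v), ?_⟩⟩
    · have hxy' : (-4 : ℂ) • x = (-4 : ℂ) • y := by
        rw [← hsq x, ← hsq y]
        exact congrArg (fun b => sharp (J b)) hxy
      exact smul_right_injective B (by norm_num : (-4 : ℂ) ≠ 0) hxy'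
    · rw [LinearMap.comp_apply, map_smul, map_smul, hsq, smul_smul]
      norm_num
  refine ⟨?_, hbij, Function.Surjective.of_comp (g := J) hbij.2, fun hJb => ?_⟩
  · ext v
    simp only [LinearMap.comp_apply, LinearMap.smul_apply, map_smul, hsq, smul_smul,
      LinearMap.neg_apply, LinearMap.id_apply]
    norm_num
  · exact (Function.Bijective.of_comp_iff sharp hJb).1 hbij
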